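/- arXiv:1406.0120 — 2 statements merged into one kernel-verified Lean document; each statement's English description precedes it below -/
import Mathlib

section
/- There exists a universal constant c_3 > 0 such that for every number field K of degree d = [K:ℚ] ≥ 2, with unit rank r_K, absolute discriminant D_K, and r_0 equal to the maximum of the unit ranks of the proper subfields of K, one has R_K ≥ c_3 · d^{−2d} · (log(|D_K| / d^d))^{r_K − r_0}. -/
/-- The maximum of the unit ranks of the proper subfields of a number field `K`.
(In characteristic zero every subfield of `K` contains `ℚ`, so proper subfields are
the intermediate fields of `K/ℚ` other than `K` itself.) -/
noncomputable def maxProperSubfieldUnitRank (K : Type*) [Field K] [NumberField K] : ℕ :=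
  sSup {n : ℕ | ∃ K₀ : IntermediateField ℚ K, K₀ ≠ ⊤ ∧ n = NumberField.Units.rank K₀}

section

open NumberField Module

theorem had_one {ι : Type*} [Fintype ι] [DecidableEq ι] (A : Matrix ι ι ℂ)
    (hA : ∀ i j, ‖A i j‖ ≤ 1) :
    ‖A.det‖ ^ 2 ≤ (Fintype.card ι : ℝ) ^ (Fintype.card ι) := by
  classical
  rcases isEmpty_or_nonempty ι with h | h
  · simp
  have hH : (A * A.conjTranspose).IsHermitian := Matrix.isHermitian_mul_conjTranspose_self A
  have hnn : ∀ i, 0 ≤ hH.eigenvalues i := fun i => by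
    open scoped ComplexOrder in
    exact (Matrix.posSemidef_self_mul_conjTranspose A).eigenvalues_nonneg i
  have hdet : (A * A.conjTranspose).det = ((‖A.det‖ ^ 2 : ℝ) : ℂ) := by
    rw [Matrix.det_mul, Matrix.det_conjTranspose]
    push_cast
    exact Complex.mul_conj' _
  have h1 : ‖A.det‖ ^ 2 = ∏ i, hH.eigenvalues i := by
    apply Complex.ofReal_injective
    rw [← hdet, hH.det_eq_prod_eigenvalues]
    simp
  have htr : ∑ i, hH.eigenvalues i = ∑ i, ∑ j, ‖A i j‖ ^ 2 := by
    have := hH.trace_eq_sum_eigenvalues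
    have h2 : (A * A.conjTranspose).trace = ((∑ i, ∑ j, ‖A i j‖ ^ 2 : ℝ) : ℂ) := by
      simp only [Matrix.trace, Matrix.diag, Matrix.mul_apply, Matrix.conjTranspose_apply]
      push_cast
      refine Finset.sum_congr rfl fun i _ => Finset.sum_congr rfl fun j _ => ?_
      exact Complex.mul_conj' _
    apply Complex.ofReal_injective
    rw [← h2, this]
    simp
  have hn : (0 : ℝ) < Fintype.card ι := by exact_mod_cast Fintype.card_pos
  have hle : ∑ i, ∑ j, ‖A i j‖ ^ 2 ≤ (Fintype.card ι : ℝ) * Fintype.card ι := by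
    calc _ ≤ ∑ i : ι, ∑ j : ι, (1 : ℝ) := by
          refine Finset.sum_le_sum fun i _ => Finset.sum_le_sum fun j _ => ?_
          exact pow_le_one₀ (norm_nonneg _) (hA i j)
      _ = _ := by simp
  have hamgm := Real.geom_mean_le_arith_mean Finset.univ (fun _ : ι => (1 : ℝ)) hH.eigenvalues
    (by simp) (by simp; exact Fintype.card_pos) (fun i _ => hnn i)
  simp only [Real.rpow_one, one_mul, Finset.sum_const, Finset.card_univ, nsmul_eq_mul,
    mul_one] at hamgm
  rw [← h1, htr] at hamgm
  have h3 : (‖A.det‖ ^ 2) ^ (Fintype.card ι : ℝ)⁻¹ ≤ Fintype.card ι :=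
    hamgm.trans (by rw [div_le_iff₀ hn]; exact hle)
  have h4 := pow_le_pow_left₀ (by positivity) h3 (Fintype.card ι)
  rwa [Real.rpow_inv_natCast_pow (by positivity) Fintype.card_ne_zero] at h4

theorem had_exp {ι : Type*} [Fintype ι] [DecidableEq ι] (A : Matrix ι ι ℂ) (g : ι → ℝ)
    (hA : ∀ i j, ‖A i j‖ ≤ Real.exp (g j)) :
    ‖A.det‖ ^ 2 ≤ (Fintype.card ι : ℝ) ^ (Fintype.card ι) * Real.exp (2 * ∑ i, g i) := by
  have h := had_one (Matrix.of fun i j => ((Real.exp (- g j) : ℝ) : ℂ) * A i j) (by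
    intro i j
    simp only [Matrix.of_apply, norm_mul, Complex.norm_real, Real.norm_eq_abs, Real.abs_exp]
    rw [Real.exp_neg, inv_mul_le_iff₀ (Real.exp_pos _), mul_one]
    exact hA i j)
  rw [Matrix.det_mul_row, norm_mul, mul_pow, norm_prod] at h
  simp only [Complex.norm_real, Real.norm_eq_abs, Real.abs_exp] at h
  rw [← Real.exp_sum, Finset.sum_neg_distrib, Real.exp_neg, inv_pow, ← Real.exp_nat_mul,
    inv_mul_le_iff₀ (Real.exp_pos _), mul_comm] at h
  exact_mod_cast h

theorem discr_le_basis {K : Type*} [Field K] [NumberField K] {ι : Type*} [Fintype ι]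
    [DecidableEq ι] (b : Basis ι ℚ K) (hb : ∀ i, IsIntegral ℤ (b i)) :
    |(discr K : ℝ)| ≤ |((Algebra.discr ℚ b : ℚ) : ℝ)| := by
  classical
  let e : ι ≃ Free.ChooseBasisIndex ℤ (𝓞 K) := b.indexEquiv (integralBasis K)
  let B : Basis ι ℚ K := (integralBasis K).reindex e.symm
  have hB : Algebra.discr ℚ B = (discr K : ℚ) := by
    rw [coe_discr]
    have := Algebra.discr_reindex ℚ (integralBasis K) e.symm
    simpa [B, Basis.coe_reindex] using this
  have hP : Algebra.discr ℚ b = (B.toMatrix b).det ^ 2 * (discr K : ℚ) := by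
    rw [← hB, ← Algebra.discr_of_matrix_vecMul, Basis.toMatrix_map_vecMul]
  let Q : Matrix ι ι ℤ := Matrix.of fun i j =>
    (RingOfIntegers.basis K).repr ⟨b j, hb j⟩ (e i)
  have hQ : B.toMatrix b = Q.map (algebraMap ℤ ℚ) := by
    ext i j
    have := integralBasis_repr_apply K ⟨b j, hb j⟩ (e i)
    simp only [Matrix.map_apply, Q, Matrix.of_apply, ← this, Basis.toMatrix_apply, B]
    simp
    rfl
  have hd : (B.toMatrix b).det = (Q.det : ℚ) := by
    rw [hQ]
    exact ((algebraMap ℤ ℚ).map_det Q).symm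
  have hne : Q.det ≠ 0 := by
    intro h0
    have := Algebra.discr_not_zero_of_basis ℚ b
    rw [hP, hd, h0] at this
    simp at this
  rw [hP, hd]
  push_cast
  rw [abs_mul]
  refine le_mul_of_one_le_left (abs_nonneg _) ?_
  have : 1 ≤ Q.det ^ 2 := by
    have := sq_pos_of_ne_zero hne
    omega
  rw [abs_of_nonneg (by positivity)]
  exact_mod_cast this

theorem discr_le_exp {K : Type*} [Field K] [NumberField K] {ι : Type*} [Fintype ι]
    (b : Basis ι ℚ K) (hb : ∀ i, IsIntegral ℤ (b i)) (g : (K →+* ℂ) → ℝ)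
    (hg : ∀ φ i, ‖φ (b i)‖ ≤ Real.exp (g φ)) :
    |(discr K : ℝ)| ≤ (finrank ℚ K : ℝ) ^ finrank ℚ K * Real.exp (2 * ∑ φ, g φ) := by
  classical
  have hc : Fintype.card ι = finrank ℚ K := (finrank_eq_card_basis b).symm
  have e : ι ≃ (K →ₐ[ℚ] ℂ) := Fintype.equivOfCardEq (by
    rw [hc, AlgHom.card])
  refine (discr_le_basis b hb).trans ?_
  have h1 := Algebra.discr_eq_det_embeddingsMatrixReindex_pow_two ℚ ℂ b e
  have h2 : |((Algebra.discr ℚ b : ℚ) : ℝ)| = ‖(Algebra.embeddingsMatrixReindex ℚ ℂ b e).det‖ ^ 2 := by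
    rw [← norm_pow, ← h1]
    simp
  rw [h2]
  have h3 := had_exp (Algebra.embeddingsMatrixReindex ℚ ℂ b e)
    (fun i => g (e i : K →+* ℂ)) (fun i j => by
      have := hg (e j : K →+* ℂ) i
      simpa [Algebra.embeddingsMatrixReindex, Algebra.embeddingsMatrix] using this)
  rw [hc] at h3
  have h4 : ∑ i, g (e i : K →+* ℂ) = ∑ φ, g φ := by
    rw [← Equiv.sum_comp (e.trans (RingHom.equivRatAlgHom (R := K) (S := ℂ)).symm) g]
    rfl
  rwa [h4] at h3

/-- A field with a basis of controlled size. -/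
def TowerP {K : Type} [Field K] [NumberField K] (H : ℝ) (F : IntermediateField ℚ K) : Prop :=
  ∃ g : (K →+* ℂ) → ℝ, (∀ φ, 0 ≤ g φ) ∧ (∑ φ, g φ ≤ ((finrank ℚ F : ℝ) - 1) * H) ∧
    ∃ (ι : Type) (_ : Fintype ι) (b : Basis ι ℚ F), ∀ j, IsIntegral ℤ (b j : K) ∧
      ∀ φ : K →+* ℂ, ‖φ (b j : K)‖ ≤ Real.exp (g φ)

theorem towerP_bot {K : Type} [Field K] [NumberField K] (H : ℝ) :
    TowerP H (⊥ : IntermediateField ℚ K) := by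
  refine ⟨0, fun _ => le_rfl, by simp, Unit, inferInstance,
    (Basis.singleton Unit ℚ).map (IntermediateField.botEquiv ℚ K).symm.toLinearEquiv, ?_⟩
  intro j
  have : (((Basis.singleton Unit ℚ).map (IntermediateField.botEquiv ℚ K).symm.toLinearEquiv) j : K)
      = 1 := by
    simp
  rw [this]
  exact ⟨isIntegral_one, fun φ => by simp⟩

theorem towerP_step {K : Type} [Field K] [NumberField K] {H : ℝ} (hH : 0 ≤ H)
    (F : IntermediateField ℚ K) (x : K) (hx : IsIntegral ℤ x)
    (hxH : ∑ φ : K →+* ℂ, Real.posLog ‖φ x‖ ≤ H) (h : TowerP H F) :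
    TowerP H (IntermediateField.restrictScalars ℚ (IntermediateField.adjoin F {x})) := by
  obtain ⟨g, hg0, hgs, ι, _, b, hb⟩ := h
  have hxint : IsIntegral F x := (hx.tower_top (A := ℚ)).tower_top
  let pb := IntermediateField.adjoin.powerBasis hxint
  let b' : Basis (ι × Fin pb.dim) ℚ (IntermediateField.adjoin F {x}) := b.smulTower pb.basis
  have hdim : (finrank ℚ (IntermediateField.adjoin F {x}) : ℝ) = finrank ℚ F * pb.dim := by
    rw [← finrank_mul_finrank ℚ F, pb.finrank]
    push_cast; rfl
  have hn1 : (1 : ℝ) ≤ finrank ℚ F := by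
    exact_mod_cast (finrank_pos : 0 < finrank ℚ F)
  have hm1 : (1 : ℝ) ≤ pb.dim := by
    have : 0 < pb.dim := by rw [← pb.finrank]; exact finrank_pos
    exact_mod_cast this
  refine ⟨fun φ => g φ + (pb.dim - 1) * Real.posLog ‖φ x‖, fun φ => ?_, ?_,
    ι × Fin pb.dim, inferInstance, b', ?_⟩
  · have := hg0 φ
    have := Real.posLog_nonneg (x := ‖φ x‖)
    have : 0 ≤ (pb.dim - 1 : ℝ) * Real.posLog ‖φ x‖ := mul_nonneg (by linarith) this
    linarith
  · rw [Finset.sum_add_distrib, ← Finset.mul_sum]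
    change _ ≤ ((finrank ℚ (IntermediateField.adjoin F {x}) : ℝ) - 1) * H
    rw [hdim]
    have h1 : (pb.dim - 1 : ℝ) * ∑ φ : K →+* ℂ, Real.posLog ‖φ x‖ ≤ (pb.dim - 1) * H :=
      mul_le_mul_of_nonneg_left hxH (by linarith)
    have h2 : 0 ≤ ((finrank ℚ F : ℝ) - 1) * (pb.dim - 1) * H :=
      mul_nonneg (mul_nonneg (by linarith) (by linarith)) hH
    nlinarith
  · rintro ⟨i, k⟩
    have hv : ((b' (i, k) : IntermediateField.adjoin F {x}) : K) = (b i : K) * x ^ (k : ℕ) := by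
      simp only [b', Basis.smulTower_apply, pb, PowerBasis.basis_eq_pow]
      rw [IntermediateField.coe_smul]
      simp [IntermediateField.smul_def]
    constructor
    · change IsIntegral ℤ ((b' (i, k) : IntermediateField.adjoin F {x}) : K)
      rw [hv]
      exact (hb i).1.mul (hx.pow _)
    · intro φ
      change ‖φ ((b' (i, k) : IntermediateField.adjoin F {x}) : K)‖ ≤ _
      rw [hv, map_mul, norm_mul, map_pow, norm_pow, Real.exp_add]
      refine mul_le_mul ((hb i).2 φ) ?_ (by positivity) (Real.exp_pos _).le
      have hk : ((k : ℕ) : ℝ) ≤ pb.dim - 1 := by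
        have := k.2
        have : (k : ℕ) + 1 ≤ pb.dim := this
        have : (((k : ℕ) + 1 : ℕ) : ℝ) ≤ pb.dim := by exact_mod_cast this
        push_cast at this; linarith
      have h1 : ‖φ x‖ ≤ Real.exp (Real.posLog ‖φ x‖) := by
        rcases (norm_nonneg (φ x)).eq_or_lt with h0 | h0
        · rw [← h0]; exact (Real.exp_pos _).le
        · calc ‖φ x‖ = Real.exp (Real.log ‖φ x‖) := (Real.exp_log h0).symm
            _ ≤ _ := Real.exp_le_exp.2 (le_max_right _ _)
      calc ‖φ x‖ ^ (k : ℕ) ≤ Real.exp (Real.posLog ‖φ x‖) ^ (k : ℕ) :=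
            pow_le_pow_left₀ (norm_nonneg _) h1 _
        _ = Real.exp (k * Real.posLog ‖φ x‖) := by rw [← Real.exp_nat_mul]
        _ ≤ _ := Real.exp_le_exp.2 (mul_le_mul_of_nonneg_right hk Real.posLog_nonneg)

theorem discr_le_of_adjoin {K : Type} [Field K] [NumberField K] {H : ℝ} (hH : 0 ≤ H)
    (S : Set K) (hS : ∀ x ∈ S, IsIntegral ℤ x)
    (hSH : ∀ x ∈ S, ∑ φ : K →+* ℂ, Real.posLog ‖φ x‖ ≤ H)
    (htop : IntermediateField.adjoin ℚ S = ⊤) :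
    |(discr K : ℝ)| ≤ (finrank ℚ K : ℝ) ^ finrank ℚ K *
      Real.exp (2 * (((finrank ℚ K : ℝ) - 1) * H)) := by
  classical
  obtain ⟨α, hα⟩ := Field.exists_primitive_element ℚ K
  have hαS : α ∈ IntermediateField.adjoin ℚ S := by rw [htop]; trivial
  obtain ⟨T, hTS, hαT⟩ := IntermediateField.exists_finset_of_mem_adjoin hαS
  have hT : IntermediateField.adjoin ℚ (T : Set K) = ⊤ := by
    rw [eq_top_iff, ← hα, IntermediateField.adjoin_le_iff]
    simpa using hαT
  have hP : TowerP H (IntermediateField.adjoin ℚ (T : Set K)) := by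
    refine IntermediateField.induction_on_adjoin_finset T (TowerP H) (towerP_bot H) ?_
    intro F x hx hF
    exact towerP_step hH F x (hS x (hTS hx)) (hSH x (hTS hx)) hF
  rw [hT] at hP
  obtain ⟨g, hg0, hgs, ι, _, b, hb⟩ := hP
  have hr : finrank ℚ (⊤ : IntermediateField ℚ K) = finrank ℚ K :=
    IntermediateField.finrank_top'
  rw [hr] at hgs
  refine (discr_le_exp (b.map (IntermediateField.topEquiv (F := ℚ) (E := K)).toLinearEquiv)
    (fun i => by rw [Basis.map_apply]; exact (hb i).1) g
    (fun φ i => by rw [Basis.map_apply]; exact (hb i).2 φ)).trans ?_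
  gcongr

theorem floor_sub_lt {a b : ℝ} (h : ⌊a⌋ = ⌊b⌋) : |a - b| < 1 := Int.abs_sub_lt_one_of_floor_eq_floor h

open NumberField.InfinitePlace in
theorem pack {F : Type*} [Field F] [NumberField F] (τ : InfinitePlace F → ℝ)
    (hτ : ∑ w, (mult w : ℝ) * τ w ≤ 2 * finrank ℚ F) (A : Finset (𝓞 F))
    (hA : ∀ α ∈ A, ∀ w : InfinitePlace F, w (α : F) ≤ Real.exp (τ w)) :
    A.card ≤ 961 ^ finrank ℚ F := by
  classical
  let f : 𝓞 F → InfinitePlace F → ℤ × ℤ := fun α w =>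
    (⌊2 * Real.exp (2 - τ w) * (w.embedding (α : F)).re⌋,
     ⌊2 * Real.exp (2 - τ w) * (w.embedding (α : F)).im⌋)
  let B : Finset (InfinitePlace F → ℤ × ℤ) :=
    Fintype.piFinset fun _ => Finset.Icc (-15) 15 ×ˢ Finset.Icc (-15) 15
  have hBc : B.card = 961 ^ Fintype.card (InfinitePlace F) := by
    simp [B, Fintype.card_piFinset]
  have he2 : Real.exp 2 < 7.5 := by
    have h1 := Real.exp_one_lt_d9
    have : Real.exp 2 = Real.exp 1 * Real.exp 1 := by rw [← Real.exp_add]; norm_num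
    rw [this]
    nlinarith [Real.exp_pos 1]
  have hbd : ∀ (w : InfinitePlace F) (y z : ℝ), |y| ≤ z → z ≤ Real.exp (τ w) →
      ⌊2 * Real.exp (2 - τ w) * y⌋ ∈ Finset.Icc (-15 : ℤ) 15 := by
    intro w y z hy hz
    have h1 : |2 * Real.exp (2 - τ w) * y| ≤ 15 := by
      rw [abs_mul, abs_of_pos (by positivity)]
      calc 2 * Real.exp (2 - τ w) * |y| ≤ 2 * Real.exp (2 - τ w) * Real.exp (τ w) := by
            gcongr; exact hy.trans hz
        _ = 2 * Real.exp 2 := by rw [mul_assoc, ← Real.exp_add]; ring_nf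
        _ ≤ 15 := by linarith
    rw [abs_le] at h1
    rw [Finset.mem_Icc]
    constructor
    · rw [Int.le_floor]; push_cast; linarith
    · have := Int.floor_le (2 * Real.exp (2 - τ w) * y)
      have : (⌊2 * Real.exp (2 - τ w) * y⌋ : ℝ) ≤ 15 := by linarith
      exact_mod_cast this
  have hmaps : ∀ α ∈ A, f α ∈ B := by
    intro α hα
    rw [Fintype.mem_piFinset]
    intro w
    rw [Finset.mem_product]
    have hw := hA α hα w
    rw [← norm_embedding_eq] at hw
    exact ⟨hbd w _ _ (Complex.abs_re_le_norm _) hw, hbd w _ _ (Complex.abs_im_le_norm _) hw⟩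
  have hinj : Set.InjOn f A := by
    intro α hα β hβ hαβ
    by_contra hne
    have hlt : ∀ w : InfinitePlace F, w ((α : F) - β) < Real.exp (τ w - 2) := by
      intro w
      have h1 := congrFun hαβ w
      simp only [f, Prod.mk.injEq] at h1
      have hre := floor_sub_lt h1.1
      have him := floor_sub_lt h1.2
      rw [← mul_sub, abs_mul, abs_of_pos (by positivity)] at hre him
      rw [← norm_embedding_eq, map_sub]
      have hn := Complex.norm_le_abs_re_add_abs_im (w.embedding (α : F) - w.embedding (β : F))
      simp only [Complex.sub_re, Complex.sub_im] at hn
      have hE : Real.exp (2 - τ w) * Real.exp (τ w - 2) = 1 := by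
        rw [← Real.exp_add]; simp
      have h2 : Real.exp (2 - τ w) * ‖w.embedding (α : F) - w.embedding (β : F)‖ < 1 := by
        nlinarith [mul_le_mul_of_nonneg_left hn (Real.exp_pos (2 - τ w)).le]
      rw [← hE] at h2
      exact lt_of_mul_lt_mul_left h2 (Real.exp_pos _).le
    have hnz : (α : F) - β ≠ 0 := by
      rw [sub_ne_zero]; exact fun h => hne (RingOfIntegers.ext h)
    have hprod := prod_eq_abs_norm ((α : F) - β)
    have h1 : ∏ w : InfinitePlace F, w ((α : F) - β) ^ mult w < 1 := by
      calc ∏ w : InfinitePlace F, w ((α : F) - β) ^ mult w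
          < ∏ w : InfinitePlace F, Real.exp (τ w - 2) ^ mult w := by
            refine Finset.prod_lt_prod_of_nonempty (fun w _ => pow_pos (InfinitePlace.pos_iff.2 hnz) _)
              (fun w _ => pow_lt_pow_left₀ (hlt w) (apply_nonneg _ _) mult_ne_zero)
              Finset.univ_nonempty
        _ = Real.exp (∑ w : InfinitePlace F, (mult w : ℝ) * (τ w - 2)) := by
            rw [Real.exp_sum]
            exact Finset.prod_congr rfl fun w _ => (Real.exp_nat_mul _ _).symm
        _ ≤ 1 := by
            rw [Real.exp_le_one_iff]
            have h3 : ∑ w : InfinitePlace F, (mult w : ℝ) = finrank ℚ F := by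
              exact_mod_cast sum_mult_eq (K := F)
            simp only [mul_sub, Finset.sum_sub_distrib, ← Finset.sum_mul, h3]
            linarith
    rw [hprod] at h1
    have h2 : 1 ≤ |Algebra.norm ℤ (α - β)| := by
      apply Int.one_le_abs
      rw [Algebra.norm_ne_zero_iff, sub_ne_zero]
      exact hne
    have h3 : (Algebra.norm ℚ ((α : F) - β)) = (Algebra.norm ℤ (α - β) : ℚ) := by
      rw [Algebra.coe_norm_int]; simp
    rw [h3] at h1
    have : ((|Algebra.norm ℤ (α - β)| : ℤ) : ℝ) < 1 := by
      push_cast at h1 ⊢; exact h1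
    have : |Algebra.norm ℤ (α - β)| < 1 := by exact_mod_cast this
    omega
  calc A.card ≤ B.card := Finset.card_le_card_of_injOn f hmaps hinj
    _ = _ := hBc
    _ ≤ _ := by
      apply Nat.pow_le_pow_right (by norm_num)
      rw [← sum_mult_eq (K := F), Fintype.card_eq_sum_ones]
      exact Finset.sum_le_sum fun w _ => mult_pos

open NumberField.Units NumberField.Units.dirichletUnitTheorem NumberField.InfinitePlace

theorem exists_unit_of_mem {F : Type*} [Field F] [NumberField F] (l : unitLattice F) :
    ∃ u : (𝓞 F)ˣ, logEmbedding F (Additive.ofMul u) = l := by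
  obtain ⟨l, hl⟩ := l
  obtain ⟨u, _, hu⟩ := hl
  exact ⟨Additive.toMul u, hu⟩

theorem card_place_eq {F : Type*} [Field F] [NumberField F] :
    Fintype.card (InfinitePlace F) = rank F + 1 := by
  have : 0 < Fintype.card (InfinitePlace F) := Fintype.card_pos
  unfold NumberField.Units.rank; omega

open scoped Classical in
theorem card_ne_place {F : Type*} [Field F] [NumberField F] :
    Fintype.card {w : InfinitePlace F // w ≠ w₀} = rank F := by
  rw [← Fintype.card_congr (equivFinRank F), Fintype.card_fin]

theorem card_place_le {F : Type*} [Field F] [NumberField F] :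
    Fintype.card (InfinitePlace F) ≤ finrank ℚ F := by
  rw [← sum_mult_eq (K := F), Fintype.card_eq_sum_ones]
  exact Finset.sum_le_sum fun w _ => mult_pos

theorem finrank_le_place {F : Type*} [Field F] [NumberField F] :
    finrank ℚ F ≤ 2 * (rank F + 1) := by
  rw [← sum_mult_eq (K := F), ← card_place_eq, mul_comm, Fintype.card_eq_sum_ones, Finset.sum_mul]
  refine Finset.sum_le_sum fun w _ => ?_
  rw [mult]; split_ifs <;> norm_num

theorem pack_cube {F : Type*} [Field F] [NumberField F] (x : logSpace F)
    (A : Finset (unitLattice F))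
    (hA : ∀ l ∈ A, ∀ w, |x w - (l : logSpace F) w| ≤ 1) : A.card ≤ 961 ^ finrank ℚ F := by
  classical
  choose u hu using exists_unit_of_mem (F := F)
  let τ : InfinitePlace F → ℝ := fun w =>
    (if h : w ≠ w₀ then x ⟨w, h⟩ + 1 else rank F - ∑ w', x w') / mult w
  have hinj : Function.Injective fun l => ((u l : (𝓞 F)ˣ) : 𝓞 F) := by
    intro l l' h
    have : u l = u l' := Units.ext h
    apply Subtype.ext
    rw [← hu l, ← hu l', this]
  have h := pack τ ?_ (A.map ⟨_, hinj⟩) ?_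
  · simpa using h
  · have h1 : ∀ w, (mult w : ℝ) * τ w =
        (if h : w ≠ w₀ then x ⟨w, h⟩ + 1 else rank F - ∑ w', x w') := fun w =>
      mul_div_cancel₀ _ mult_coe_ne_zero
    simp only [h1]
    rw [Fintype.sum_eq_add_sum_subtype_ne _ w₀]
    have h2 : ∀ w : {w : InfinitePlace F // w ≠ w₀},
      (if h : (w : InfinitePlace F) ≠ w₀ then x ⟨w, h⟩ + 1 else rank F - ∑ w', x w') = x w + 1 :=
      fun w => by rw [dif_pos w.2]
    simp only [h2]
    rw [Finset.sum_add_distrib]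
    simp only [ne_eq, not_true_eq_false, dite_false, Finset.sum_const, Finset.card_univ,
      nsmul_eq_mul, mul_one]
    rw [card_ne_place]
    have h3 : (rank F : ℝ) ≤ finrank ℚ F := by
      have := card_place_le (F := F)
      rw [card_place_eq] at this
      exact_mod_cast (by omega : rank F ≤ finrank ℚ F)
    linarith
  · intro α hα w
    simp only [Finset.mem_map, Function.Embedding.coeFn_mk] at hα
    obtain ⟨l, hl, rfl⟩ := hα
    have hpos : 0 < w ((u l : 𝓞 F) : F) := Units.pos_at_place _ _
    rw [← Real.log_le_iff_le_exp hpos, le_div_iff₀' (by exact_mod_cast mult_pos)]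
    have hc := hA l hl
    split_ifs with h
    · have := hc ⟨w, h⟩
      rw [← hu l, logEmbedding_component, abs_le] at this
      simp only at this
      linarith [this.1]
    · have h : w = w₀ := not_not.1 h
      subst h
      have h1 := sum_logEmbedding_component (u l)
      rw [hu l] at h1
      have h2 : ∑ w', (x w' - (l : logSpace F) w') ≤ rank F := by
        calc ∑ w', (x w' - (l : logSpace F) w') ≤ ∑ w' : {w : InfinitePlace F // w ≠ w₀}, (1 : ℝ) :=
              Finset.sum_le_sum fun w' _ => (le_abs_self _).trans (hc w')
          _ = rank F := by simp [← card_ne_place (F := F)]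
      rw [Finset.sum_sub_distrib, h1] at h2
      linarith

theorem pack_ball {F : Type*} [Field F] [NumberField F] {T : ℝ} (hT : 1 ≤ T)
    (A : Finset (unitLattice F))
    (hA : ∀ l ∈ A, ∀ w, |(l : logSpace F) w| ≤ T) :
    (A.card : ℝ) ≤ 961 ^ finrank ℚ F * (4 * T) ^ rank F := by
  classical
  let f : unitLattice F → {w : InfinitePlace F // w ≠ w₀} → ℤ := fun l w =>
    ⌊(l : logSpace F) w⌋
  let M : ℤ := ⌊T⌋
  let B : Finset ({w : InfinitePlace F // w ≠ w₀} → ℤ) :=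
    Fintype.piFinset fun _ => Finset.Icc (-M - 1) M
  have hM : (M : ℝ) ≤ T := Int.floor_le T
  have hM1 : 1 ≤ M := by
    rw [Int.le_floor]; exact_mod_cast hT
  have hBc : (B.card : ℝ) ≤ (4 * T) ^ rank F := by
    simp only [B, Fintype.card_piFinset, Int.card_Icc, Finset.prod_const, Finset.card_univ,
      card_ne_place, Nat.cast_pow]
    gcongr
    have h1 : (((M + 1 - (-M - 1)).toNat : ℤ) : ℝ) = (2 * M + 2 : ℝ) := by
      rw [Int.toNat_of_nonneg (by omega)]; push_cast; ring
    have h2 : ((M + 1 - (-M - 1)).toNat : ℝ) = (2 * M + 2 : ℝ) := by exact_mod_cast h1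
    rw [h2]
    linarith
  have hmaps : ∀ l ∈ A, f l ∈ B := by
    intro l hl
    rw [Fintype.mem_piFinset]
    intro w
    have := hA l hl w
    rw [abs_le] at this
    rw [Finset.mem_Icc]
    constructor
    · rw [Int.le_floor]; push_cast
      have := Int.lt_floor_add_one T
      change (-(⌊T⌋ : ℝ) - 1) ≤ _
      linarith
    · exact Int.floor_le_floor this.2
  have h1 : A.card ≤ 961 ^ finrank ℚ F * B.card := by
    refine Finset.card_le_mul_card_image_of_maps_to hmaps _ ?_
    intro b hb
    refine pack_cube (fun w => (b w : ℝ)) _ ?_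
    intro l hl w
    rw [Finset.mem_filter] at hl
    have h2 : ⌊(l : logSpace F) w⌋ = b w := congrFun hl.2 w
    rw [Int.floor_eq_iff] at h2
    rw [abs_le]
    constructor <;> linarith [h2.1, h2.2]
  calc (A.card : ℝ) ≤ 961 ^ finrank ℚ F * B.card := by exact_mod_cast h1
    _ ≤ _ := by gcongr

open MeasureTheory in
open scoped Classical Pointwise in
theorem volume_le_regulator {F : Type*} [Field F] [NumberField F] (s : Set (logSpace F))
    (hs : MeasurableSet s) (N : ℝ) (hN0 : 0 ≤ N)
    (hN : ∀ (x : logSpace F) (A : Finset (unitLattice F)),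
      (∀ l ∈ A, x - (l : logSpace F) ∈ s) → (A.card : ℝ) ≤ N) :
    volume.real s ≤ N * regulator F := by
  have i1 : MeasurableVAdd (unitLattice F) (logSpace F) :=
    (inferInstance : MeasurableVAdd (unitLattice F).toAddSubgroup (logSpace F))
  have i2 : VAddInvariantMeasure (unitLattice F) (logSpace F) volume :=
    (inferInstance : VAddInvariantMeasure (unitLattice F).toAddSubgroup (logSpace F) volume)
  let D := ZSpan.fundamentalDomain (Basis.ofZLatticeBasis ℝ (unitLattice F) (basisUnitLattice F))
  have hD : IsAddFundamentalDomain (unitLattice F) D volume :=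
    ZLattice.isAddFundamentalDomain (basisUnitLattice F) volume
  have hR : regulator F = volume.real D := by
    rw [NumberField.Units.regulator]
    exact ZLattice.covolume_eq_measure_fundamentalDomain _ _ hD
  have hfin : volume D ≠ ⊤ := by
    exact (ZSpan.fundamentalDomain_isBounded _).measure_lt_top.ne
  have key : volume s ≤ ENNReal.ofReal N * volume D := by
    rw [hD.measure_eq_tsum s]
    have h1 : ∀ g : unitLattice F, volume ((g +ᵥ s) ∩ D) =
        ∫⁻ x in D, (g +ᵥ s).indicator (fun _ => 1) x := by
      intro g
      rw [lintegral_indicator_const (hs.const_vadd g) 1, one_mul, Measure.restrict_apply (hs.const_vadd g)]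
    simp only [h1]
    rw [← lintegral_tsum]
    · rw [← setLIntegral_const]
      refine lintegral_mono fun x => ?_
      rw [ENNReal.tsum_eq_iSup_sum]
      refine iSup_le fun A => ?_
      have h2 : ∑ g ∈ A, (g +ᵥ s).indicator (fun _ => (1 : ENNReal)) x =
          ((A.filter fun g => x ∈ g +ᵥ s).card : ENNReal) := by
        rw [Finset.card_filter]
        push_cast
        exact Finset.sum_congr rfl fun g _ => by rw [Set.indicator_apply]
      rw [h2]
      have h3 := hN x (A.filter fun g => x ∈ g +ᵥ s) (by
        intro l hl
        rw [Finset.mem_filter, Set.mem_vadd_set_iff_neg_vadd_mem] at hl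
        have := hl.2
        rwa [Submodule.vadd_def, Submodule.coe_neg, vadd_eq_add, neg_add_eq_sub] at this)
      rw [← ENNReal.ofReal_natCast]
      exact ENNReal.ofReal_le_ofReal h3
    · intro g
      exact (measurable_const.indicator (hs.const_vadd g)).aemeasurable
  rw [hR, Measure.real, Measure.real]
  have := ENNReal.toReal_mono (ENNReal.mul_ne_top ENNReal.ofReal_ne_top hfin) key
  rwa [ENNReal.toReal_mul, ENNReal.toReal_ofReal hN0] at this

open MeasureTheory in
open scoped Classical in
theorem regulator_ge_const {F : Type*} [Field F] [NumberField F] :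
    1 ≤ 961 ^ finrank ℚ F * regulator F := by
  have h := volume_le_regulator (F := F) (Set.Icc (fun _ => -1) (fun _ => 1)) measurableSet_Icc
    (961 ^ finrank ℚ F) (by positivity) (by
      intro x A hA
      exact_mod_cast pack_cube x A (by
        intro l hl w
        have := hA l hl
        rw [Set.mem_Icc] at this
        rw [abs_le]
        exact ⟨this.1 w, this.2 w⟩))
  refine le_trans ?_ h
  rw [Measure.real, Real.volume_Icc_pi, ENNReal.toReal_prod]
  have : (ENNReal.ofReal (1 - -1 : ℝ)).toReal = 2 := by
    rw [ENNReal.toReal_ofReal] <;> norm_num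
  rw [Finset.prod_const, this]
  exact one_le_pow₀ (by norm_num)

open MeasureTheory in
theorem volume_l1 {ι : Type*} [Fintype ι] {ρ : ℝ} (hρ : 0 < ρ) :
    volume.real {x : ι → ℝ | ∑ i, |x i| < ρ} =
      (2 * ρ) ^ Fintype.card ι / (Fintype.card ι).factorial := by
  rcases isEmpty_or_nonempty ι with h | h
  · have : {x : ι → ℝ | ∑ i, |x i| < ρ} = Set.univ := by
      ext x; simp [hρ]
    rw [this]
    simp [Measure.real, MeasureTheory.volume_pi]
  · have := MeasureTheory.volume_sum_rpow_lt ι (p := 1) le_rfl ρ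
    simp only [Real.rpow_one, div_one] at this
    rw [Measure.real, this, ENNReal.toReal_mul, ENNReal.toReal_pow, ENNReal.toReal_ofReal hρ.le,
      ENNReal.toReal_ofReal, Real.Gamma_nat_eq_factorial]
    · have : Real.Gamma (1 + 1) = 1 := by norm_num [Real.Gamma_two]
      rw [this, mul_one, mul_pow]
      ring
    · have : Real.Gamma (1 + 1) = 1 := by norm_num [Real.Gamma_two]
      rw [this, Real.Gamma_nat_eq_factorial]
      positivity

theorem sum_emb_eq {K : Type*} [Field K] [NumberField K] (x : K) (f : ℝ → ℝ) :
    ∑ φ : K →+* ℂ, f ‖φ x‖ = ∑ w : InfinitePlace K, (mult w : ℝ) * f (w x) := by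
  classical
  rw [← Finset.sum_fiberwise (s := Finset.univ) (g := fun φ : K →+* ℂ => InfinitePlace.mk φ)]
  refine Finset.sum_congr rfl fun w _ => ?_
  rw [← card_filter_mk_eq w, ← nsmul_eq_mul, ← Finset.sum_const]
  refine Finset.sum_congr rfl fun φ hφ => ?_
  rw [Finset.mem_filter] at hφ
  rw [← hφ.2, InfinitePlace.apply]

theorem posLog_unit_le {K : Type*} [Field K] [NumberField K] (u : (𝓞 K)ˣ) {T : ℝ}
    (h : ∑ w : InfinitePlace K, (mult w : ℝ) * |Real.log (w ((u : 𝓞 K) : K))| ≤ T) :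
    ∑ φ : K →+* ℂ, Real.posLog ‖φ ((u : 𝓞 K) : K)‖ ≤ T / 2 := by
  rw [sum_emb_eq]
  have h1 := sum_mult_mul_log u
  have h2 : ∀ w : InfinitePlace K, (mult w : ℝ) * Real.posLog (w ((u : 𝓞 K) : K)) =
      ((mult w : ℝ) * |Real.log (w ((u : 𝓞 K) : K))| +
        (mult w : ℝ) * Real.log (w ((u : 𝓞 K) : K))) / 2 := by
    intro w
    have : Real.posLog (w ((u : 𝓞 K) : K)) = (|Real.log (w ((u : 𝓞 K) : K))| +
        Real.log (w ((u : 𝓞 K) : K))) / 2 := by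
      rw [Real.posLog]
      rcases le_total 0 (Real.log (w ((u : 𝓞 K) : K))) with h | h
      · rw [max_eq_right h, abs_of_nonneg h]; ring
      · rw [max_eq_left h, abs_of_nonpos h]; ring
    rw [this]; ring
  simp only [h2]
  rw [← Finset.sum_div, Finset.sum_add_distrib, h1]
  linarith

open scoped Classical in
theorem sum_abs_log_le {K : Type*} [Field K] [NumberField K] (u : (𝓞 K)ˣ) :
    ∑ w : InfinitePlace K, (mult w : ℝ) * |Real.log (w ((u : 𝓞 K) : K))| ≤
      2 * ∑ w, |logEmbedding K (Additive.ofMul u) w| := by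
  rw [Fintype.sum_eq_add_sum_subtype_ne _ w₀]
  have h1 := sum_logEmbedding_component u
  have h2 : (mult (w₀ : InfinitePlace K) : ℝ) * |Real.log (w₀ ((u : 𝓞 K) : K))| =
      |∑ w, logEmbedding K (Additive.ofMul u) w| := by
    rw [h1, abs_mul, abs_neg, Nat.abs_cast]
  have h3 : ∀ w : {w : InfinitePlace K // w ≠ w₀},
      (mult (w : InfinitePlace K) : ℝ) * |Real.log ((w : InfinitePlace K) ((u : 𝓞 K) : K))| =
      |logEmbedding K (Additive.ofMul u) w| := by
    intro w
    rw [logEmbedding_component, abs_mul, Nat.abs_cast]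
  rw [h2]
  simp only [h3]
  have := Finset.abs_sum_le_sum_abs (fun w => logEmbedding K (Additive.ofMul u) w) Finset.univ
  linarith

theorem exists_unit_subfield {K : Type*} [Field K] [NumberField K] (F : IntermediateField ℚ K)
    (u : (𝓞 K)ˣ) (hu : ((u : 𝓞 K) : K) ∈ F) :
    ∃ v : (𝓞 F)ˣ, (((v : 𝓞 F) : F) : K) = ((u : 𝓞 K) : K) := by
  have hi : ∀ x : (𝓞 K)ˣ, ∀ hx : ((x : 𝓞 K) : K) ∈ F, IsIntegral ℤ (⟨_, hx⟩ : F) := by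
    intro x hx
    have := RingOfIntegers.isIntegral_coe (x : 𝓞 K)
    rw [← isIntegral_algebraMap_iff (B := K) (A := F) (algebraMap F K).injective]
    exact this
  have hmul : ((u : 𝓞 K) : K) * (((u⁻¹ : (𝓞 K)ˣ) : 𝓞 K) : K) = 1 := by
    rw [← map_mul, Units.mul_inv, map_one]
  have hu' : (((u⁻¹ : (𝓞 K)ˣ) : 𝓞 K) : K) ∈ F := by
    rw [eq_inv_of_mul_eq_one_right hmul]
    exact F.inv_mem hu
  refine ⟨⟨⟨_, hi u hu⟩, ⟨_, hi u⁻¹ hu'⟩, ?_, ?_⟩, rfl⟩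
  · apply RingOfIntegers.ext
    apply Subtype.ext
    exact hmul
  · apply RingOfIntegers.ext
    apply Subtype.ext
    exact (mul_comm _ _).trans hmul

theorem rank_subfield_le {K : Type*} [Field K] [NumberField K] (F : IntermediateField ℚ K) :
    rank F ≤ rank K := by
  have h1 := card_place_eq (F := F)
  have h2 := card_place_eq (F := K)
  have : Fintype.card (InfinitePlace F) ≤ Fintype.card (InfinitePlace K) :=
    Fintype.card_le_of_surjective _ (comap_surjective (k := F) (K := K))
  omega

open scoped Classical in
theorem count_subfield {K : Type*} [Field K] [NumberField K] (F : IntermediateField ℚ K) {T : ℝ}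
    (hT : 1 ≤ T)
    (hF : ∀ u : (𝓞 K)ˣ, ∑ w : InfinitePlace K, (mult w : ℝ) * |Real.log (w ((u : 𝓞 K) : K))| < T →
      ((u : 𝓞 K) : K) ∈ F)
    (A : Finset (unitLattice K)) (hA : ∀ l ∈ A, ∑ w, |(l : logSpace K) w| < T / 2) :
    (A.card : ℝ) ≤ 961 ^ finrank ℚ F * (4 * T) ^ rank F := by
  choose u hu using exists_unit_of_mem (F := K)
  have hsm : ∀ l ∈ A, ∑ w : InfinitePlace K,
      (mult w : ℝ) * |Real.log (w ((u l : 𝓞 K) : K))| < T := by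
    intro l hl
    refine (sum_abs_log_le _).trans_lt ?_
    rw [hu l]
    linarith [hA l hl]
  have hex : ∀ l : unitLattice K, ∃ v : (𝓞 F)ˣ, l ∈ A →
      (((v : 𝓞 F) : F) : K) = ((u l : 𝓞 K) : K) := by
    intro l
    by_cases hl : l ∈ A
    · obtain ⟨v, hv⟩ := exists_unit_subfield F (u l) (hF _ (hsm l hl))
      exact ⟨v, fun _ => hv⟩
    · exact ⟨1, fun h => absurd h hl⟩
  choose v hv using hex
  let f : unitLattice K → unitLattice F := fun l =>
    ⟨logEmbedding F (Additive.ofMul (v l)), Submodule.mem_map_of_mem trivial⟩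
  have hplace : ∀ l ∈ A, ∀ W : InfinitePlace K,
      (W.comap (algebraMap F K)) ((v l : 𝓞 F) : F) = W ((u l : 𝓞 K) : K) := by
    intro l hl W
    rw [comap_apply]
    exact congrArg W (hv l hl)
  have hinj : Set.InjOn f A := by
    intro l hl l' hl' h
    have h1 : logEmbedding F (Additive.ofMul (v l)) = logEmbedding F (Additive.ofMul (v l')) :=
      congrArg Subtype.val h
    have h2 : logEmbedding F (Additive.ofMul (v l * (v l')⁻¹)) = 0 := by
      rw [ofMul_mul, ofMul_inv, map_add, map_neg, h1, add_neg_cancel]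
    rw [logEmbedding_eq_zero_iff, mem_torsion] at h2
    apply Subtype.ext
    rw [← hu l, ← hu l']
    ext W
    rw [logEmbedding_component, logEmbedding_component]
    congr 2
    rw [← hplace l hl, ← hplace l' hl']
    have h3 := h2 (W.1.comap (algebraMap F K))
    have h4 : ((v l : 𝓞 F) : F) = (((v l * (v l')⁻¹ : (𝓞 F)ˣ) : 𝓞 F) : F) * ((v l' : 𝓞 F) : F) := by
      rw [← map_mul, ← Units.val_mul, inv_mul_cancel_right]
    rw [h4, map_mul, h3, one_mul]
  rw [← Finset.card_image_of_injOn hinj]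
  refine pack_ball hT _ ?_
  intro m hm w
  rw [Finset.mem_image] at hm
  obtain ⟨l, hl, rfl⟩ := hm
  obtain ⟨W, hW⟩ := comap_surjective (k := F) (K := K) w.1
  simp only [f]
  rw [logEmbedding_component, abs_mul, Nat.abs_cast]
  simp only at hW
  rw [← hW, hplace l hl]
  calc _ ≤ (mult W : ℝ) * |Real.log (W ((u l : 𝓞 K) : K))| := by
        gcongr
        exact mult_comap_le _ _
    _ ≤ ∑ w : InfinitePlace K, (mult w : ℝ) * |Real.log (w ((u l : 𝓞 K) : K))| :=
        Finset.single_le_sum (f := fun w : InfinitePlace K =>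
          (mult w : ℝ) * |Real.log (w ((u l : 𝓞 K) : K))|)
          (fun w _ => by positivity) (Finset.mem_univ W)
    _ ≤ T := (hsm l hl).le

open MeasureTheory in
open scoped Classical in
theorem large_case {K : Type} [Field K] [NumberField K] {T : ℝ} (hT : 1 ≤ T)
    (hL : Real.log (|(discr K : ℝ)| / (finrank ℚ K : ℝ) ^ finrank ℚ K) = finrank ℚ K * T) :
    ∃ F : IntermediateField ℚ K, F ≠ ⊤ ∧
      (T / 2) ^ rank K / (rank K).factorial ≤
        961 ^ finrank ℚ F * (4 * T) ^ rank F * regulator K := by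
  let S : Set K := {x | ∃ u : (𝓞 K)ˣ, ((u : 𝓞 K) : K) = x ∧
    ∑ w : InfinitePlace K, (mult w : ℝ) * |Real.log (w ((u : 𝓞 K) : K))| < T}
  have hd : 0 < (finrank ℚ K : ℝ) := by exact_mod_cast finrank_pos
  refine ⟨IntermediateField.adjoin ℚ S, ?_, ?_⟩
  · intro htop
    have h := discr_le_of_adjoin (H := T / 2) (by linarith) S (by
        rintro x ⟨u, rfl, _⟩
        exact RingOfIntegers.isIntegral_coe _) (by
        rintro x ⟨u, rfl, hu⟩
        exact posLog_unit_le u hu.le) htop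
    have hD : 0 < |(discr K : ℝ)| := by
      rw [abs_pos]; exact_mod_cast discr_ne_zero K
    have h2 : |(discr K : ℝ)| / (finrank ℚ K : ℝ) ^ finrank ℚ K ≤
        Real.exp (2 * (((finrank ℚ K : ℝ) - 1) * (T / 2))) := by
      rw [div_le_iff₀' (by positivity)]; exact h
    rw [← Real.log_le_iff_le_exp (by positivity), hL] at h2
    nlinarith
  · set F := IntermediateField.adjoin ℚ S
    have hmeas : MeasurableSet {x : logSpace K | ∑ w, |x w| < T / 4} := by
      apply IsOpen.measurableSet
      exact isOpen_lt (by fun_prop) continuous_const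
    have h := volume_le_regulator {x : logSpace K | ∑ w, |x w| < T / 4} hmeas
      (961 ^ finrank ℚ F * (4 * T) ^ rank F) (by positivity) (by
        intro x A hA
        rcases A.eq_empty_or_nonempty with rfl | ⟨l₀, hl₀⟩
        · simp only [Finset.card_empty, Nat.cast_zero]; positivity
        have hc : A.card = (A.image fun l => l - l₀).card :=
          (Finset.card_image_of_injective _ (sub_left_injective)).symm
        rw [hc]
        refine count_subfield F hT ?_ _ ?_
        · intro u hu
          exact IntermediateField.subset_adjoin ℚ S ⟨u, rfl, hu⟩
        · intro m hm
          rw [Finset.mem_image] at hm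
          obtain ⟨l, hl, rfl⟩ := hm
          have h1 := hA l hl
          have h2 := hA l₀ hl₀
          rw [Set.mem_ofPred_eq] at h1 h2
          calc ∑ w, |((l - l₀ : unitLattice K) : logSpace K) w|
              ≤ ∑ w, (|(x - (l : logSpace K)) w| + |(x - (l₀ : logSpace K)) w|) := by
                refine Finset.sum_le_sum fun w _ => ?_
                have : ((l - l₀ : unitLattice K) : logSpace K) w =
                  (x - (l₀ : logSpace K)) w - (x - (l : logSpace K)) w := by
                  simp
                rw [this, add_comm]
                exact abs_sub _ _
            _ < T / 2 := by
                rw [Finset.sum_add_distrib]; linarith)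
    rw [volume_l1 (by linarith), card_ne_place] at h
    convert h using 3
    ring

theorem two_pow_fact_le (r : ℕ) : 2 ^ r * r.factorial ≤ (r + 1) ^ r := by
  induction r with
  | zero => simp
  | succ r ih =>
    have h1 : 2 * (r + 1) ^ (r + 1) ≤ (r + 1 + 1) ^ (r + 1) := by
      have h := pow_add_mul_le_add_pow (R := ℕ) (a := r + 1) (b := 1) (by simp) (by simp) (r + 1)
      simp only [mul_one, Nat.add_sub_cancel, Nat.cast_id] at h
      calc 2 * (r + 1) ^ (r + 1) = _ := by ring
        _ ≤ _ := h
    calc 2 ^ (r + 1) * (r + 1).factorial = 2 * (r + 1) * (2 ^ r * r.factorial) := by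
          rw [Nat.factorial_succ]; ring
      _ ≤ 2 * (r + 1) * (r + 1) ^ r := by gcongr
      _ = 2 * (r + 1) ^ (r + 1) := by ring
      _ ≤ _ := h1

theorem pow_bound {C : ℝ} (hC : 1 ≤ C) : ∃ B : ℝ, 1 ≤ B ∧ ∀ (x : ℝ) (q : ℕ), 1 ≤ x →
    (q : ℝ) ≤ x ^ 2 → C ^ q ≤ B * x ^ q := by
  refine ⟨C ^ ⌈C ^ 2⌉₊, one_le_pow₀ hC, fun x q hx hq => ?_⟩
  have hB : 1 ≤ C ^ ⌈C ^ 2⌉₊ := one_le_pow₀ hC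
  rcases le_total C x with h | h
  · have h1 : C ^ q ≤ x ^ q := by gcongr
    nlinarith [pow_pos (zero_lt_one.trans_le hx) q]
  · have h1 : (q : ℝ) ≤ C ^ 2 := hq.trans (by gcongr)
    have h2 : q ≤ ⌈C ^ 2⌉₊ := by
      exact_mod_cast h1.trans (Nat.le_ceil _)
    have h3 : C ^ q ≤ C ^ ⌈C ^ 2⌉₊ := pow_le_pow_right₀ hC h2
    nlinarith [one_le_pow₀ hx (n := q)]

theorem large_arith {T B R : ℝ} {d r q a n : ℕ} (hT : 1 ≤ T) (hd : 2 ≤ d) (hr : r + 1 ≤ d)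
    (hB : 1 ≤ B) (haq : a + q ≤ r) (hn : n ≤ 2 * (q + 1))
    (hBq : (4 * 961 ^ 2 : ℝ) ^ q ≤ B * (d : ℝ) ^ q)
    (h : (T / 2) ^ r / r.factorial ≤ 961 ^ n * (4 * T) ^ q * R) (hR : 0 ≤ R) :
    (961 ^ 2 * B)⁻¹ * ((d : ℝ) ^ (2 * d))⁻¹ * (d * T) ^ a ≤ R := by
  have hT0 : 0 < T := by linarith
  have hd0 : (1 : ℝ) ≤ d := by exact_mod_cast (by omega : 1 ≤ d)
  have hd1 : (0 : ℝ) < d := by linarith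
  have hf : (2 : ℝ) ^ r * r.factorial ≤ (d : ℝ) ^ r := by
    have h1 := two_pow_fact_le r
    calc (2 : ℝ) ^ r * r.factorial ≤ ((r + 1 : ℕ) : ℝ) ^ r := by exact_mod_cast h1
      _ ≤ (d : ℝ) ^ r := by gcongr
  have h1 : T ^ r ≤ (2 ^ r * r.factorial) * (961 ^ n * (4 * T) ^ q * R) := by
    rw [div_pow, div_div, div_le_iff₀' (by positivity)] at h
    exact h
  have h2 : (961 : ℝ) ^ n ≤ 961 ^ (2 * (q + 1)) := pow_le_pow_right₀ (by norm_num) hn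
  have h3 : T ^ a * T ^ q ≤ T ^ r := by
    rw [← pow_add]; exact pow_le_pow_right₀ hT haq
  have h4 : T ^ a * T ^ q ≤ ((d : ℝ) ^ r * (961 ^ 2 * (B * (d : ℝ) ^ q)) * R) * T ^ q := by
    calc T ^ a * T ^ q ≤ T ^ r := h3
      _ ≤ (2 ^ r * r.factorial) * (961 ^ n * (4 * T) ^ q * R) := h1
      _ ≤ (d : ℝ) ^ r * (961 ^ (2 * (q + 1)) * (4 * T) ^ q * R) := by gcongr
      _ = ((d : ℝ) ^ r * (961 ^ 2 * (4 * 961 ^ 2 : ℝ) ^ q) * R) * T ^ q := by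
        rw [mul_pow, mul_pow, ← pow_mul, mul_add, pow_add]; ring
      _ ≤ _ := by gcongr
  have h5 : T ^ a ≤ (d : ℝ) ^ r * (961 ^ 2 * (B * (d : ℝ) ^ q)) * R :=
    le_of_mul_le_mul_right h4 (by positivity)
  have h6 : (d : ℝ) ^ a * (d ^ r * d ^ q) ≤ (d : ℝ) ^ (2 * d) := by
    rw [← pow_add, ← pow_add]
    exact pow_le_pow_right₀ hd0 (by omega)
  rw [← mul_inv, inv_mul_le_iff₀ (by positivity), mul_pow]
  calc (d : ℝ) ^ a * T ^ a ≤ (d : ℝ) ^ a * ((d : ℝ) ^ r * (961 ^ 2 * (B * (d : ℝ) ^ q)) * R) := by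
        gcongr
    _ = 961 ^ 2 * B * ((d : ℝ) ^ a * (d ^ r * d ^ q)) * R := by ring
    _ ≤ _ := by gcongr

theorem small_arith {L B R D : ℝ} {d a : ℕ} (hd : 2 ≤ d) (hB : 1 ≤ B) (ha : a ≤ d)
    (hD : 1 ≤ D) (hL : L = Real.log (D / (d : ℝ) ^ d)) (hLd : L ≤ d)
    (hBq : (4 * 961 ^ 2 : ℝ) ^ d ≤ B * Real.sqrt d ^ d)
    (hR : 1 ≤ 961 ^ d * R) :
    (961 ^ 2 * B)⁻¹ * ((d : ℝ) ^ (2 * d))⁻¹ * L ^ a ≤ R := by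
  have hd0 : (1 : ℝ) ≤ d := by exact_mod_cast (by omega : 1 ≤ d)
  have hd1 : (0 : ℝ) < d := by linarith
  set s := Real.sqrt d with hs
  have hss : s ^ 2 = d := Real.sq_sqrt hd1.le
  have hs1 : 1 ≤ s := by rw [hs, Real.one_le_sqrt]; exact hd0
  have hR0 : 0 < R := by
    by_contra hneg
    have : (961 : ℝ) ^ d * R ≤ 0 := mul_nonpos_of_nonneg_of_nonpos (by positivity) (not_lt.1 hneg)
    linarith
  have hlog : Real.log d ≤ 2 * s := by
    rw [← hss, Real.log_pow]
    have := Real.log_le_sub_one_of_pos (x := s) (by linarith)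
    push_cast; linarith
  have habs : |L| ≤ 2 * s ^ 3 := by
    rw [abs_le]
    constructor
    · rw [hL, Real.log_div (by positivity) (by positivity), Real.log_pow]
      have h1 : 0 ≤ Real.log D := Real.log_nonneg hD
      have h2 : d * Real.log d ≤ 2 * s ^ 3 := by
        calc d * Real.log d ≤ d * (2 * s) := by gcongr
          _ = 2 * s ^ 3 := by rw [← hss]; ring
      linarith
    · rw [← hss] at hLd
      nlinarith [sq_nonneg s]
  have h1 : L ^ a ≤ (2 * s ^ 3) ^ d := by
    calc L ^ a ≤ |L| ^ a := by rw [← abs_pow]; exact le_abs_self _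
      _ ≤ (2 * s ^ 3) ^ a := by gcongr
      _ ≤ (2 * s ^ 3) ^ d := by
        apply pow_le_pow_right₀ _ ha
        nlinarith [one_le_pow₀ hs1 (n := 3)]
  have h2 : (2 * 961 : ℝ) ^ d ≤ B * s ^ d := by
    refine le_trans ?_ hBq
    gcongr <;> norm_num
  rw [← mul_inv, inv_mul_le_iff₀ (by positivity)]
  calc L ^ a ≤ (2 * s ^ 3) ^ d * 1 := by rw [mul_one]; exact h1
    _ ≤ (2 * s ^ 3) ^ d * (961 ^ d * R) := by gcongr
    _ = (2 * 961) ^ d * (s ^ (3 * d) * R) := by rw [mul_pow, mul_pow, ← pow_mul]; ring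
    _ ≤ (B * s ^ d) * (s ^ (3 * d) * R) := by gcongr
    _ = 1 * B * (d : ℝ) ^ (2 * d) * R := by
      rw [← hss, ← pow_mul]
      ring_nf
    _ ≤ 961 ^ 2 * B * (d : ℝ) ^ (2 * d) * R := by gcongr; norm_num

theorem regulator_aux : ∃ c₃ : ℝ, 0 < c₃ ∧ ∀ (K : Type) (_ : Field K) (_ : NumberField K),
    2 ≤ finrank ℚ K →
      c₃ * (finrank ℚ K : ℝ) ^ (-(2 * (finrank ℚ K : ℤ))) *
        (Real.log (|(discr K : ℝ)| / (finrank ℚ K : ℝ) ^ (finrank ℚ K))) ^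
          (rank K - maxProperSubfieldUnitRank K) ≤ regulator K := by
  obtain ⟨B, hB, hBx⟩ := pow_bound (C := 4 * 961 ^ 2) (by norm_num)
  refine ⟨(961 ^ 2 * B)⁻¹, by positivity, fun K _ _ hd => ?_⟩
  have hz : (finrank ℚ K : ℝ) ^ (-(2 * (finrank ℚ K : ℤ))) =
      ((finrank ℚ K : ℝ) ^ (2 * finrank ℚ K))⁻¹ := by
    rw [zpow_neg]; congr 1
  rw [hz]
  have hd0 : (1 : ℝ) ≤ finrank ℚ K := by exact_mod_cast (by omega : 1 ≤ finrank ℚ K)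
  have hrd : rank K + 1 ≤ finrank ℚ K := by
    rw [← card_place_eq]; exact card_place_le
  by_cases hL : (finrank ℚ K : ℝ) ≤
      Real.log (|(discr K : ℝ)| / (finrank ℚ K : ℝ) ^ (finrank ℚ K))
  · set L := Real.log (|(discr K : ℝ)| / (finrank ℚ K : ℝ) ^ (finrank ℚ K)) with hLdef
    have hdT : L = finrank ℚ K * (L / finrank ℚ K) := by field_simp
    have hT : 1 ≤ L / finrank ℚ K := by rw [le_div_iff₀ (by linarith)]; linarith
    obtain ⟨F, hF, h⟩ := large_case hT hdT
    have hq : rank F ≤ maxProperSubfieldUnitRank K := by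
      refine le_csSup ⟨rank K, ?_⟩ ⟨F, hF, rfl⟩
      rintro n ⟨K₀, _, rfl⟩
      exact rank_subfield_le K₀
    have hqr := rank_subfield_le F
    rw [hdT]
    refine large_arith hT hd hrd hB (by omega) (finrank_le_place (F := F)) ?_ h ?_
    · refine hBx _ _ hd0 ?_
      have : (rank F : ℝ) ≤ finrank ℚ K := by exact_mod_cast (by omega : rank F ≤ finrank ℚ K)
      nlinarith
    · exact (regulator_pos K).le
  · refine small_arith hd hB (by omega) ?_ rfl (not_le.1 hL).le ?_ regulator_ge_const
    · have : (1 : ℤ) ≤ |discr K| := Int.one_le_abs (discr_ne_zero K)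
      exact_mod_cast this
    · refine hBx _ _ ?_ ?_
      · rw [Real.one_le_sqrt]; exact hd0
      · rw [Real.sq_sqrt (by positivity)]

end

/-- Silverman, Friedman: there is a universal constant `c₃ > 0` such that every number field
`K` of degree `d ≥ 2`, with unit rank `r_K`, absolute discriminant `D_K` and `r₀` the maximum
of the unit ranks of its proper subfields, satisfies
`R_K ≥ c₃ · d^(-2d) · (log(|D_K| / d^d))^(r_K - r₀)`. -/
theorem regulator_ge_of_discr :
    ∃ c₃ : ℝ, 0 < c₃ ∧ ∀ (K : Type) (_ : Field K) (_ : NumberField K),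
      2 ≤ Module.finrank ℚ K →
      NumberField.Units.regulator K ≥
        c₃ * (Module.finrank ℚ K : ℝ) ^ (-(2 * (Module.finrank ℚ K : ℤ))) *
          (Real.log (|(NumberField.discr K : ℝ)| /
              (Module.finrank ℚ K : ℝ) ^ (Module.finrank ℚ K))) ^
            (NumberField.Units.rank K - maxProperSubfieldUnitRank K) := by
  exact regulator_aux
end

section
/- Let K be a CM field and let K_0 be its maximal totally real subfield, and let r_0 denote the unit rank of K_0. Then there exists an integer s with r_0 − 1 ≤ s ≤ r_0 such that the regulators satisfy R_K = 2^s · R_{K_0}. -/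
open NumberField in
theorem cm_aux (K : Type*) [Field K] [NumberField K] [IsCMField K]
    (E : Subfield K) (hE : E = maximalRealSubfield K) :
    ∃ s : ℤ, (Units.rank E : ℤ) - 1 ≤ s ∧ s ≤ (Units.rank E : ℤ) ∧
      Units.regulator K = 2 ^ s * Units.regulator E := by
  subst hE
  have h := IsCMField.regulator_div_regulator_eq_two_pow_mul_indexRealUnits_inv K
  rw [← IsCMField.units_rank_eq_units_rank K,
    div_eq_iff (Units.regulator_ne_zero _)] at h
  rcases IsCMField.indexRealUnits_eq_one_or_two K with h1 | h1
  · refine ⟨Units.rank (maximalRealSubfield K), by omega, le_refl _, ?_⟩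
    rw [h, h1]
    simp
  · refine ⟨(Units.rank (maximalRealSubfield K) : ℤ) - 1, le_refl _, by omega, ?_⟩
    rw [h, h1, zpow_sub₀ (by norm_num)]
    simp [div_eq_mul_inv]

/-- Let `K` be a CM field, i.e. a totally imaginary number field which is a quadratic
extension of its maximal totally real subfield `K₀`, and let `r₀` be the unit rank of `K₀`.
Then `R_K = 2^s · R_{K₀}` for some integer `s` with `r₀ - 1 ≤ s ≤ r₀`. -/
theorem regulator_CM_eq_two_pow_mul_regulator
    (K : Type*) [Field K] [NumberField K]
    (him : ∀ φ : K →+* ℂ, ¬ NumberField.ComplexEmbedding.IsReal φ)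
    (K₀ : IntermediateField ℚ K)
    (hreal : ∀ φ : K₀ →+* ℂ, NumberField.ComplexEmbedding.IsReal φ)
    (h2 : Module.finrank K₀ K = 2) :
    ∃ s : ℤ, (NumberField.Units.rank K₀ : ℤ) - 1 ≤ s ∧ s ≤ (NumberField.Units.rank K₀ : ℤ) ∧
      NumberField.Units.regulator K = 2 ^ s * NumberField.Units.regulator K₀ := by
  have : NumberField.IsTotallyComplex K := ⟨fun v => by
    rw [NumberField.InfinitePlace.isComplex_iff]
    exact him _⟩
  have : NumberField.IsTotallyReal K₀ := ⟨fun v => by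
    rw [NumberField.InfinitePlace.isReal_iff]
    exact hreal _⟩
  have : Algebra.IsQuadraticExtension K₀ K := ⟨h2⟩
  have : NumberField.IsCMField K := NumberField.IsCMField.ofCMExtension K₀ K
  have hR : NumberField.IsTotallyReal K₀.toSubfield := ‹NumberField.IsTotallyReal K₀›
  have hQ : Algebra.IsQuadraticExtension K₀.toSubfield K :=
    ‹Algebra.IsQuadraticExtension K₀ K›
  exact cm_aux K K₀.toSubfield
    (NumberField.CMExtension.eq_maximalRealSubfield K K₀.toSubfield)
end
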